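/- arXiv:2206.15424 — 2 statements merged into one kernel-verified Lean document; each statement's English description precedes it below -/
import Mathlib

section
/- Let G be a connected graph in which no three distinct vertices are pairwise true twins, X a cluster modulator of G, and 𝒞 an equivalence class of identical cliques of G − X with |𝒞| ≥ |X| + 2 and t(𝒞) ≥ 1. Then for every minimum resolving set S of G, at most |X| + 1 cliques C ∈ 𝒞 satisfy |S ∩ V(C)| ≥ t(𝒞) + 1. -/
open SimpleGraph

variable {V : Type*}

/-- Two distinct vertices are true twins if they have equal closed neighborhoods. -/
def TrueTwins (G : SimpleGraph V) (u v : V) : Prop :=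
  u ≠ v ∧ insert u (G.neighborSet u) = insert v (G.neighborSet v)

/-- Two distinct vertices are false twins if they have equal open neighborhoods. -/
def FalseTwins (G : SimpleGraph V) (u v : V) : Prop :=
  u ≠ v ∧ G.neighborSet u = G.neighborSet v

/-- A set `S` is a resolving set of `G`. -/
def IsResolving {W : Type*} (G : SimpleGraph W) (S : Set W) : Prop :=
  ∀ u v : W, u ≠ v → ∃ w ∈ S, G.dist w u ≠ G.dist w v

/-- A graph is a cluster graph: every connected component is a clique. -/
def IsClusterGraph {W : Type*} (H : SimpleGraph W) : Prop :=
  ∀ a b : W, H.Reachable a b → a = b ∨ H.Adj a b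

/-- `X` is a cluster modulator of `G`: `G - X` is a cluster graph. -/
def IsClusterModulator (G : SimpleGraph V) (X : Set V) : Prop :=
  IsClusterGraph (G.induce Xᶜ)

/-- `C` is a clique of `G - X`, i.e. a connected component of `G - X`
(which is a clique when `X` is a cluster modulator). -/
def IsCliqueComponent (G : SimpleGraph V) (X C : Set V) : Prop :=
  C.Nonempty ∧ C ⊆ Xᶜ ∧ (∀ a ∈ C, ∀ b ∈ C, a ≠ b → G.Adj a b) ∧
    (∀ a ∈ C, ∀ b : V, b ∉ X → G.Adj a b → b ∈ C)

/-- Two vertices are clones (w.r.t. the modulator `X`) if they have the same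
neighborhood in `X`. -/
def Clones (G : SimpleGraph V) (X : Set V) (u v : V) : Prop :=
  G.neighborSet u ∩ X = G.neighborSet v ∩ X

/-- Two cliques of `G - X` are identical if their signatures (multisets of
neighborhoods in `X`) coincide, i.e. there is a bijection matching vertices
with equal neighborhoods in `X`. -/
def Identical (G : SimpleGraph V) (X C1 C2 : Set V) : Prop :=
  ∃ f : ↥C1 ≃ ↥C2, ∀ u : ↥C1, G.neighborSet (↑(f u)) ∩ X = G.neighborSet (↑u) ∩ X

/-- `𝒞` is an equivalence class of identical cliques of `G - X`:
a maximal set of pairwise identical cliques of `G - X`. -/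
def IsIdenticalClass (G : SimpleGraph V) (X : Set V) (𝒞 : Set (Set V)) : Prop :=
  (∀ C ∈ 𝒞, IsCliqueComponent G X C) ∧
  (∀ C1 ∈ 𝒞, ∀ C2 ∈ 𝒞, Identical G X C1 C2) ∧
  (∀ C, IsCliqueComponent G X C → (∃ C' ∈ 𝒞, Identical G X C C') → C ∈ 𝒞)

/-- The number of unordered pairs of true twins of `G` contained in `C`. -/
noncomputable def twinPairCount (G : SimpleGraph V) (C : Set V) : ℕ :=
  {p : Set V | ∃ u ∈ C, ∃ v ∈ C, TrueTwins G u v ∧ p = {u, v}}.ncard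

/-- No three distinct vertices of `G` are pairwise true twins. -/
def NoThreeTrueTwins (G : SimpleGraph V) : Prop :=
  ¬ ∃ u v w : V, TrueTwins G u v ∧ TrueTwins G u w ∧ TrueTwins G v w

/-- No three distinct vertices of `G` are pairwise false twins. -/
def NoThreeFalseTwins (G : SimpleGraph V) : Prop :=
  ¬ ∃ u v w : V, FalseTwins G u v ∧ FalseTwins G u w ∧ FalseTwins G v w

/-- `I` is an independent set of `G - X` corresponding to a connected component
of the complement of `G - X`. -/
def IsCoComponent (G : SimpleGraph V) (X I : Set V) : Prop :=
  I.Nonempty ∧ I ⊆ Xᶜ ∧ (∀ a ∈ I, ∀ b ∈ I, a ≠ b → ¬ G.Adj a b) ∧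
    (∀ a ∈ I, ∀ b : V, b ∉ X → a ≠ b → ¬ G.Adj a b → b ∈ I)

/-- A walk leaving a connected component of `G - X` passes through `X`. -/
lemma exists_modulator_dist_add_le {G : SimpleGraph V} (hG : G.Connected) {X C : Set V}
    (hC : IsCliqueComponent G X C) {a b : V} (p : G.Walk a b) (ha : a ∈ C) (hb : b ∉ C) :
    ∃ x ∈ X, G.dist a x + G.dist x b ≤ p.length := by
  induction p with
  | nil => exact absurd ha hb
  | @cons a c b h q ih =>
    have hac : G.dist a c = 1 := dist_eq_one_iff_adj.2 h
    rw [Walk.length_cons]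
    by_cases hc : c ∈ X
    · exact ⟨c, hc, by have := dist_le q; omega⟩
    · obtain ⟨x, hx, hle⟩ := ih (hC.2.2.2 a ha c hc h) hb
      exact ⟨x, hx, by have := hG.dist_triangle (u := a) (v := c) (w := x); omega⟩

/-- If a vertex of a component of `G - X` resolves two vertices outside that component,
then so does some vertex of `X`. -/
lemma exists_modulator_dist_ne {G : SimpleGraph V} (hG : G.Connected) {X C : Set V}
    (hC : IsCliqueComponent G X C) {w u v : V} (hw : w ∈ C) (hu : u ∉ C) (hv : v ∉ C)
    (hne : G.dist w u ≠ G.dist w v) : ∃ x ∈ X, G.dist x u ≠ G.dist x v := by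
  by_contra! h
  obtain ⟨p, hp⟩ := hG.exists_walk_length_eq_dist w u
  obtain ⟨q, hq⟩ := hG.exists_walk_length_eq_dist w v
  obtain ⟨x, hx, hxle⟩ := exists_modulator_dist_add_le hG hC p hw hu
  obtain ⟨y, hy, hyle⟩ := exists_modulator_dist_add_le hG hC q hw hv
  have := h x hx
  have := h y hy
  have := hG.dist_triangle (u := w) (v := x) (w := v)
  have := hG.dist_triangle (u := w) (v := y) (w := u)
  omega

/-- Distinct vertices of a clique of `G - X` with equal neighborhoods in `X` are true twins. -/
lemma IsCliqueComponent.trueTwins {G : SimpleGraph V} {X C : Set V}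
    (hC : IsCliqueComponent G X C) {u v : V} (hu : u ∈ C) (hv : v ∈ C) (huv : u ≠ v)
    (h : ∀ x ∈ X, G.Adj x u ↔ G.Adj x v) : TrueTwins G u v := by
  have key : ∀ a ∈ C, ∀ y, y ∈ insert a (G.neighborSet a) ↔ y ∈ C ∨ (y ∈ X ∧ G.Adj y a) := by
    intro a ha y
    simp only [Set.mem_insert_iff, mem_neighborSet]
    constructor
    · rintro (rfl | hay)
      · exact Or.inl ha
      · by_cases hy : y ∈ X
        · exact Or.inr ⟨hy, hay.symm⟩
        · exact Or.inl (hC.2.2.2 a ha y hy hay)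
    · rintro (hy | hy)
      · by_cases hya : y = a
        · exact Or.inl hya
        · exact Or.inr (hC.2.2.1 a ha y hy (Ne.symm hya))
      · exact Or.inr hy.2.symm
  refine ⟨huv, Set.ext fun y => ?_⟩
  rw [key u hu, key v hv]
  exact or_congr_right (and_congr_right fun hy => h y hy)

/-- Distinct cliques of `G - X` are disjoint. -/
lemma IsCliqueComponent.eq_of_mem {G : SimpleGraph V} {X C D : Set V}
    (hC : IsCliqueComponent G X C) (hD : IsCliqueComponent G X D) {a : V} (haC : a ∈ C)
    (haD : a ∈ D) : C = D := by
  have key : ∀ {C D : Set V}, IsCliqueComponent G X C → IsCliqueComponent G X D →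
      a ∈ C → a ∈ D → C ⊆ D := by
    intro C D hC hD haC haD b hb
    by_cases hab : a = b
    · exact hab ▸ haD
    · exact hD.2.2.2 a haD b (hC.2.1 hb) (hC.2.2.1 a haC b hb hab)
  exact (key hC hD haC haD).antisymm (key hD hC haD haC)

/-- The true twin pairs inside `C` are hit by a set of at most `twinPairCount G C` vertices
of `C`. -/
lemma exists_twin_transversal [Finite V] (G : SimpleGraph V) (C : Set V) :
    ∃ T ⊆ C, T.ncard ≤ twinPairCount G C ∧
      ∀ u ∈ C, ∀ v ∈ C, TrueTwins G u v → u ∈ T ∨ v ∈ T := by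
  set P : Set (Set V) := {p | ∃ u ∈ C, ∃ v ∈ C, TrueTwins G u v ∧ p = {u, v}}
  have hmem : ∀ p : Set V, p ∈ P → ∃ a, a ∈ p ∧ a ∈ C := by
    rintro p ⟨u, hu, v, -, -, rfl⟩
    exact ⟨u, by simp, hu⟩
  choose f hf using hmem
  refine ⟨Set.range fun p : P => f p p.2, ?_, ?_, ?_⟩
  · rintro _ ⟨p, rfl⟩
    exact (hf p p.2).2
  · rw [← Set.image_univ]
    exact (Set.ncard_image_le Set.finite_univ).trans
      (by rw [Set.ncard_univ, Nat.card_coe_set_eq]; rfl)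
  · intro u hu v hv huv
    have hp : ({u, v} : Set V) ∈ P := ⟨u, hu, v, hv, huv, rfl⟩
    rcases (hf _ hp).1 with h | h
    · exact Or.inl ⟨⟨_, hp⟩, h⟩
    · exact Or.inr ⟨⟨_, hp⟩, h⟩

/-- In a resolving set, the vertices in a family of cliques of `G - X` may be exchanged for
nonempty transversals of their twin pairs, once all of `X` is added. -/
lemma IsResolving.exchange {G : SimpleGraph V} (hG : G.Connected) {X : Set V}
    {B : Set (Set V)} (hB : ∀ C ∈ B, IsCliqueComponent G X C) {T : Set V → Set V}
    (hTC : ∀ C ∈ B, T C ⊆ C) (hTne : ∀ C ∈ B, (T C).Nonempty)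
    (hT : ∀ C ∈ B, ∀ u ∈ C, ∀ v ∈ C, TrueTwins G u v → u ∈ T C ∨ v ∈ T C)
    {S : Set V} (hS : IsResolving G S) :
    IsResolving G ((X ∪ (S \ ⋃ C ∈ B, C)) ∪ ⋃ C ∈ B, T C) := by
  set S' : Set V := (X ∪ (S \ ⋃ C ∈ B, C)) ∪ ⋃ C ∈ B, T C
  have hXS : ∀ x ∈ X, x ∈ S' := fun x hx => Or.inl (Or.inl hx)
  have hTS : ∀ C ∈ B, ∀ x ∈ T C, x ∈ S' := fun C hC x hx => Or.inr (Set.mem_biUnion hC hx)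
  have hself : ∀ u v : V, u ≠ v → u ∈ S' → ∃ w ∈ S', G.dist w u ≠ G.dist w v := by
    intro u v huv hu
    refine ⟨u, hu, ?_⟩
    rw [dist_self]
    exact (hG.pos_dist_of_ne huv).ne
  have hbig : ∀ u v : V, u ≠ v → ∀ C ∈ B, u ∈ C → ∃ w ∈ S', G.dist w u ≠ G.dist w v := by
    intro u v huv C hC hu
    by_cases hv : v ∈ C
    · by_cases h : ∀ x ∈ X, G.Adj x u ↔ G.Adj x v
      · rcases hT C hC u hu v hv ((hB C hC).trueTwins hu hv huv h) with h | h
        · exact hself u v huv (hTS C hC u h)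
        · obtain ⟨w, hw, hne⟩ := hself v u huv.symm (hTS C hC v h)
          exact ⟨w, hw, hne.symm⟩
      · push Not at h
        obtain ⟨x, hx, h⟩ := h
        refine ⟨x, hXS x hx, fun heq => ?_⟩
        rw [← dist_eq_one_iff_adj, ← dist_eq_one_iff_adj, heq] at h
        tauto
    · by_cases hvX : v ∈ X
      · obtain ⟨w, hw, hne⟩ := hself v u huv.symm (hXS v hvX)
        exact ⟨w, hw, hne.symm⟩
      · obtain ⟨c, hc⟩ := hTne C hC
        have hcC := hTC C hC hc
        refine ⟨c, hTS C hC c hc, fun heq => ?_⟩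
        by_cases hcu : c = u
        · subst hcu
          rw [dist_self] at heq
          exact (hG.pos_dist_of_ne huv).ne heq
        · rw [dist_eq_one_iff_adj.2 ((hB C hC).2.2.1 c hcC u hu hcu)] at heq
          exact hv ((hB C hC).2.2.2 c hcC v hvX (dist_eq_one_iff_adj.1 heq.symm))
  intro u v huv
  by_cases hu : ∃ C ∈ B, u ∈ C
  · obtain ⟨C, hC, hu⟩ := hu
    exact hbig u v huv C hC hu
  by_cases hv : ∃ C ∈ B, v ∈ C
  · obtain ⟨C, hC, hv⟩ := hv
    obtain ⟨w, hw, hne⟩ := hbig v u huv.symm C hC hv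
    exact ⟨w, hw, hne.symm⟩
  obtain ⟨w, hw, hne⟩ := hS u v huv
  by_cases hwB : ∃ C ∈ B, w ∈ C
  · obtain ⟨C, hC, hwC⟩ := hwB
    obtain ⟨x, hx, hxne⟩ := exists_modulator_dist_ne hG (hB C hC) hwC
      (fun h => hu ⟨C, hC, h⟩) (fun h => hv ⟨C, hC, h⟩) hne
    exact ⟨x, hXS x hx, hxne⟩
  · exact ⟨w, Or.inl (Or.inr ⟨hw, by simpa using hwB⟩), hne⟩

/-- partition bound when `t(𝒞) ≥ 1`. -/
theorem class_partition_bound_t_pos [Fintype V] (G : SimpleGraph V) (hG : G.Connected)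
    (hT : NoThreeTrueTwins G) (X : Set V) (hX : IsClusterModulator G X)
    (𝒞 : Set (Set V)) (h𝒞 : IsIdenticalClass G X 𝒞)
    (t : ℕ) (ht : ∀ C ∈ 𝒞, twinPairCount G C = t) (htpos : 1 ≤ t)
    (hcard : X.ncard + 2 ≤ 𝒞.ncard)
    (S : Set V) (hS : IsResolving G S)
    (hmin : ∀ T : Set V, IsResolving G T → S.ncard ≤ T.ncard) :
    {C ∈ 𝒞 | t + 1 ≤ (S ∩ C).ncard}.ncard ≤ X.ncard + 1 := by
  set B : Set (Set V) := {C ∈ 𝒞 | t + 1 ≤ (S ∩ C).ncard}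
  have hB : ∀ C ∈ B, IsCliqueComponent G X C := fun C hC => h𝒞.1 C hC.1
  choose T hTC hTcard hTtwin using exists_twin_transversal G
  have hTne : ∀ C ∈ B, (T C).Nonempty := by
    intro C hC
    have h : 0 < twinPairCount G C := by rw [ht C hC.1]; exact htpos
    obtain ⟨_, u, hu, v, hv, huv, -⟩ := Set.nonempty_of_ncard_ne_zero h.ne'
    rcases hTtwin C u hu v hv huv with h | h
    exacts [⟨u, h⟩, ⟨v, h⟩]
  have hle := hmin _ (hS.exchange hG hB (fun C _ => hTC C) hTne (fun C _ => hTtwin C))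
  have hBfin : B.Finite := B.toFinite
  have hupper : (⋃ C ∈ B, T C).ncard ≤ B.ncard * t := by
    refine (hBfin.ncard_biUnion_le T).trans ?_
    rw [finsum_mem_eq_finite_toFinset_sum _ hBfin, Set.ncard_eq_toFinset_card B]
    refine Finset.sum_le_card_nsmul _ _ _ fun C hC => ?_
    exact (hTcard C).trans (ht C (hBfin.mem_toFinset.1 hC).1).le
  have hlower : B.ncard * (t + 1) ≤ (S ∩ ⋃ C ∈ B, C).ncard := by
    have hdisj : B.PairwiseDisjoint fun C => S ∩ C := fun C hC D hD hCD =>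
      Set.disjoint_left.2 fun _ haC haD => hCD ((hB C hC).eq_of_mem (hB D hD) haC.2 haD.2)
    rw [Set.inter_iUnion₂, hBfin.ncard_biUnion (fun _ _ => Set.toFinite _) hdisj,
      finsum_mem_eq_finite_toFinset_sum _ hBfin, Set.ncard_eq_toFinset_card B]
    exact Finset.card_nsmul_le_sum _ _ _ fun C hC => (hBfin.mem_toFinset.1 hC).2
  have hsplit := Set.ncard_inter_add_ncard_sdiff_eq_ncard S (⋃ C ∈ B, C)
  have h1 := Set.ncard_union_le (X ∪ (S \ ⋃ C ∈ B, C)) (⋃ C ∈ B, T C)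
  have h2 := Set.ncard_union_le X (S \ ⋃ C ∈ B, C)
  rw [mul_add, mul_one] at hlower
  omega
end

section
/- Let G be a connected graph, X a cluster modulator of G, and C1, C2 two distinct identical cliques of G − X. Let u1 ∈ C1 and v2 ∈ C2 be arbitrary vertices, let u2 ∈ C2 be a clone of u1, and let v1 ∈ C1 be a clone of v2. Then d(u1, v2) = d(u2, v1). -/
open SimpleGraph

variable {V : Type*}

/-- A map sending adjacent vertices to equal or adjacent vertices does not increase distances. -/
theorem dist_map_le_of_adj {W : Type*} {G : SimpleGraph V} {H : SimpleGraph W}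
    (hG : G.Connected) (φ : V → W) (hφ : ∀ a b, G.Adj a b → φ a = φ b ∨ H.Adj (φ a) (φ b))
    (a b : V) : H.dist (φ a) (φ b) ≤ G.dist a b := by
  have key : ∀ {a b : V} (p : G.Walk a b), ∃ q : H.Walk (φ a) (φ b), q.length ≤ p.length := by
    intro a b p
    induction p with
    | nil => exact ⟨.nil, le_rfl⟩
    | cons h p ih =>
      obtain ⟨q, hq⟩ := ih
      rcases hφ _ _ h with he | hadj
      · exact ⟨q.copy he.symm rfl, by simp; omega⟩
      · exact ⟨.cons hadj q, by simpa using hq⟩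
  obtain ⟨p, hp⟩ := hG.exists_walk_length_eq_dist a b
  obtain ⟨q, hq⟩ := key p
  exact hp ▸ (dist_le q).trans hq

theorem Clones.symm {G : SimpleGraph V} {X : Set V} {u v : V} (h : Clones G X u v) :
    Clones G X v u :=
  Eq.symm h

theorem Clones.adj {G : SimpleGraph V} {X : Set V} {u v x : V} (h : Clones G X u v)
    (hx : x ∈ X) (hu : G.Adj u x) : G.Adj v x :=
  (h.subset ⟨hu, hx⟩ : x ∈ G.neighborSet v ∩ X).1

theorem IsCliqueComponent.subset_of_mem {G : SimpleGraph V} {X C D : Set V}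
    (hC : IsCliqueComponent G X C) (hD : IsCliqueComponent G X D) {a : V}
    (haC : a ∈ C) (haD : a ∈ D) : C ⊆ D := by
  intro b hb
  by_cases hab : a = b
  · exact hab ▸ haD
  · exact hD.2.2.2 a haD b (hC.2.1 hb) (hC.2.2.1 a haC b hb hab)

theorem IsCliqueComponent.disjoint {G : SimpleGraph V} {X C D : Set V}
    (hC : IsCliqueComponent G X C) (hD : IsCliqueComponent G X D) (hne : C ≠ D) :
    Disjoint C D :=
  Set.disjoint_left.2 fun _ haC haD =>
    hne ((hC.subset_of_mem hD haC haD).antisymm (hD.subset_of_mem hC haD haC))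

theorem Identical.symm {G : SimpleGraph V} {X C D : Set V} (h : Identical G X C D) :
    Identical G X D C := by
  obtain ⟨f, hf⟩ := h
  exact ⟨f.symm, fun u => by simpa using (hf (f.symm u)).symm⟩

theorem Identical.exists_clone {G : SimpleGraph V} {X C D : Set V} (h : Identical G X C D)
    {a : V} (ha : a ∈ C) : ∃ b ∈ D, Clones G X a b := by
  obtain ⟨f, hf⟩ := h
  exact ⟨f ⟨a, ha⟩, (f ⟨a, ha⟩).2, (hf ⟨a, ha⟩).symm⟩

/-- Exchanging two cliques of `G - X` along clones, and fixing every other vertex, sends adjacent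
vertices to equal or adjacent vertices. -/
theorem adj_map_of_exchange {G : SimpleGraph V} {X C D : Set V}
    (hC : IsCliqueComponent G X C) (hD : IsCliqueComponent G X D) {φ : V → V}
    (hφC : ∀ x ∈ C, φ x ∈ D) (hφD : ∀ x ∈ D, φ x ∈ C) (hφ : ∀ x, x ∉ C → x ∉ D → φ x = x)
    (hcl : ∀ x, Clones G X x (φ x)) {a b : V} (hab : G.Adj a b) :
    φ a = φ b ∨ G.Adj (φ a) (φ b) := by
  have fix : ∀ x ∈ X, φ x = x := fun x hx =>
    hφ x (fun h => hC.2.1 h hx) (fun h => hD.2.1 h hx)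
  by_cases hbX : b ∈ X
  · rw [fix b hbX]
    exact .inr ((hcl a).adj hbX hab)
  by_cases haX : a ∈ X
  · rw [fix a haX]
    exact .inr ((hcl b).adj haX hab.symm).symm
  by_cases haC : a ∈ C
  · exact or_iff_not_imp_left.2
      (hD.2.2.1 _ (hφC a haC) _ (hφC b (hC.2.2.2 a haC b hbX hab)))
  by_cases haD : a ∈ D
  · exact or_iff_not_imp_left.2
      (hC.2.2.1 _ (hφD a haD) _ (hφD b (hD.2.2.2 a haD b hbX hab)))
  rw [hφ a haC haD, hφ b (fun h => haC (hC.2.2.2 b h a haX hab.symm))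
    (fun h => haD (hD.2.2.2 b h a haX hab.symm))]
  exact .inr hab

theorem dist_le_of_clones {G : SimpleGraph V} (hG : G.Connected) {X C D : Set V}
    (hC : IsCliqueComponent G X C) (hD : IsCliqueComponent G X D) (hne : C ≠ D)
    (hid : Identical G X C D) {u v u' v' : V} (hu : u ∈ C) (hv : v ∈ D) (hu' : u' ∈ D)
    (hv' : v' ∈ C) (hcu : Clones G X u u') (hcv : Clones G X v v') :
    G.dist u' v' ≤ G.dist u v := by
  have hdisj := Set.disjoint_left.1 (hC.disjoint hD hne)
  have huv : u ≠ v := fun h => hdisj hu (h ▸ hv)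
  have hex : ∀ x, ∃ y, (x ∈ C → y ∈ D) ∧ (x ∈ D → y ∈ C) ∧ (x ∉ C → x ∉ D → y = x) ∧
      Clones G X x y ∧ (x = u → y = u') ∧ (x = v → y = v') := by
    intro x
    by_cases hxu : x = u
    · subst hxu
      exact ⟨u', fun _ => hu', fun h => (hdisj hu h).elim, fun h => (h hu).elim, hcu,
        fun _ => rfl, fun h => (huv h).elim⟩
    by_cases hxv : x = v
    · subst hxv
      exact ⟨v', fun h => (hdisj h hv).elim, fun _ => hv', fun _ h => (h hv).elim, hcv,
        fun h => (hxu h).elim, fun _ => rfl⟩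
    by_cases hxC : x ∈ C
    · obtain ⟨y, hy, hxy⟩ := hid.exists_clone hxC
      exact ⟨y, fun _ => hy, fun h => (hdisj hxC h).elim, fun h => (h hxC).elim, hxy,
        fun h => (hxu h).elim, fun h => (hxv h).elim⟩
    by_cases hxD : x ∈ D
    · obtain ⟨y, hy, hxy⟩ := hid.symm.exists_clone hxD
      exact ⟨y, fun h => (hxC h).elim, fun _ => hy, fun _ h => (h hxD).elim, hxy,
        fun h => (hxu h).elim, fun h => (hxv h).elim⟩
    · exact ⟨x, fun h => (hxC h).elim, fun h => (hxD h).elim, fun _ _ => rfl, rfl,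
        fun h => (hxu h).elim, fun h => (hxv h).elim⟩
  choose φ hφC hφD hφ hcl hφu hφv using hex
  have h := dist_map_le_of_adj hG φ
    (fun _ _ => adj_map_of_exchange hC hD hφC hφD hφ hcl) u v
  rwa [hφu u rfl, hφv v rfl] at h

/-- cross distances between clones in identical cliques coincide. -/
theorem clones_cross_dist [Fintype V] (G : SimpleGraph V) (hG : G.Connected)
    (X : Set V) (hX : IsClusterModulator G X)
    (C1 C2 : Set V) (hC1 : IsCliqueComponent G X C1) (hC2 : IsCliqueComponent G X C2)
    (hne : C1 ≠ C2) (hid : Identical G X C1 C2)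
    (u1 v1 u2 v2 : V) (hu1 : u1 ∈ C1) (hv1 : v1 ∈ C1) (hu2 : u2 ∈ C2) (hv2 : v2 ∈ C2)
    (hcu : Clones G X u1 u2) (hcv : Clones G X v2 v1) :
    G.dist u1 v2 = G.dist u2 v1 := by
  exact le_antisymm
    (dist_le_of_clones hG hC2 hC1 hne.symm hid.symm hu2 hv1 hu1 hv2 hcu.symm hcv.symm)
    (dist_le_of_clones hG hC1 hC2 hne hid hu1 hv2 hu2 hv1 hcu hcv)
end
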